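/- Let u ∈ C²(closure 𝔻) solve −Δu = 2K e^u in 𝔻 and ∂u/∂ν + 2 = 2h e^{u/2} on ∂𝔻. Then for every C¹ vector field F : closure 𝔻 → ℝ² the following Pohozaev-type identity holds: ∫_{∂𝔻} [ 2K e^u (F·ν) + (2h e^{u/2} − 2)(∇u · F) − (|∇u|²/2)(F·ν) ] = ∫_𝔻 [ 2 e^u ( ∇K · F + K div F ) + DF(∇u, ∇u) − div F · |∇u|²/2 ], where DF(∇u,∇u) = Σ_{i,j} ∂_j F_i ∂_i u ∂_j u. -/

import Mathlib

open MeasureTheory Filter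

noncomputable section

/-- The open unit disk in ℝ² ≅ ℂ. -/
def unitDisk : Set ℂ := Metric.ball 0 1

/-- The closed unit disk. -/
def unitClosedDisk : Set ℂ := Metric.closedBall 0 1

/-- The unit circle ∂𝔻. -/
def unitCircle : Set ℂ := Metric.sphere 0 1

/-- Arc-length measure: the 1-dimensional Hausdorff measure on ℂ. -/
def arcMeasure : Measure ℂ := μH[1]

/-- Directional derivative of `u` at `z` in direction `v`. -/
def dirDeriv (v : ℂ) (u : ℂ → ℝ) (z : ℂ) : ℝ := fderiv ℝ u z v

/-- Euclidean gradient of `u` at `z`, realized as a complex number. -/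
def grad (u : ℂ → ℝ) (z : ℂ) : ℂ := ⟨dirDeriv 1 u z, dirDeriv Complex.I u z⟩

/-- Euclidean Laplacian. -/
def lap (u : ℂ → ℝ) (z : ℂ) : ℝ :=
  dirDeriv 1 (dirDeriv 1 u) z + dirDeriv Complex.I (dirDeriv Complex.I u) z

/-- Outward normal derivative on the unit circle: ν(z) = z. -/
def normalDeriv (u : ℂ → ℝ) (z : ℂ) : ℝ := fderiv ℝ u z z

/-- Tangential derivative on the unit circle: τ(z) = iz. -/
def tangentialDeriv (u : ℂ → ℝ) (z : ℂ) : ℝ := fderiv ℝ u z (Complex.I * z)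

/-- Euclidean dot product on ℂ ≅ ℝ². -/
def dot (z w : ℂ) : ℝ := z.re * w.re + z.im * w.im

/-- `u` solves `-Δu = 2K e^u` in 𝔻, `∂u/∂ν + 2 = 2h e^{u/2}` on ∂𝔻. -/
def SolvesLiouville (K h u : ℂ → ℝ) : Prop :=
  (∀ z ∈ unitDisk, -lap u z = 2 * K z * Real.exp (u z)) ∧
  (∀ z ∈ unitCircle, normalDeriv u z + 2 = 2 * h z * Real.exp (u z / 2))

/-- Convergence in C² on a set: uniform convergence of the derivatives up to order 2. -/
def TendstoC2On (F : ℕ → ℂ → ℝ) (G : ℂ → ℝ) (s : Set ℂ) : Prop :=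
  ∀ i : ℕ, i ≤ 2 →
    TendstoUniformlyOn (fun n => iteratedFDeriv ℝ i (F n)) (iteratedFDeriv ℝ i G)
      Filter.atTop s

/-- `sup u_n → +∞` on the closed disk. -/
def BlowsUp (u : ℕ → ℂ → ℝ) : Prop :=
  ∀ M : ℝ, ∀ᶠ n in Filter.atTop, ∃ z ∈ unitClosedDisk, M < u n z

/-- `u_n → -∞` locally uniformly on `s`. -/
def TendstoLocallyUniformlyBotOn (u : ℕ → ℂ → ℝ) (s : Set ℂ) : Prop :=
  ∀ (M : ℝ) (S : Set ℂ), IsCompact S → S ⊆ s →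
    ∀ᶠ n in Filter.atTop, ∀ z ∈ S, u n z < M

/-- Bounded total mass: area plus boundary length. -/
def MassBound (u : ℕ → ℂ → ℝ) (C : ℝ) : Prop :=
  ∀ n, (∫ z in unitDisk, Real.exp (u n z)) +
       (∫ z in unitCircle, Real.exp (u n z / 2) ∂arcMeasure) ≤ C

/-- Divergence of a vector field `F : ℂ → ℂ ≅ ℝ² → ℝ²`. -/
def divergence (F : ℂ → ℂ) (z : ℂ) : ℝ :=
  fderiv ℝ (fun w => (F w).re) z 1 + fderiv ℝ (fun w => (F w).im) z Complex.I

/-- The quadratic form `DF(∇u, ∇u) = Σ_{i,j} ∂_j F_i ∂_i u ∂_j u`. -/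
def DFQuad (F : ℂ → ℂ) (u : ℂ → ℝ) (z : ℂ) : ℝ :=
  fderiv ℝ (fun w => (F w).re) z 1 * dirDeriv 1 u z * dirDeriv 1 u z +
  fderiv ℝ (fun w => (F w).re) z Complex.I * dirDeriv 1 u z * dirDeriv Complex.I u z +
  fderiv ℝ (fun w => (F w).im) z 1 * dirDeriv Complex.I u z * dirDeriv 1 u z +
  fderiv ℝ (fun w => (F w).im) z Complex.I * dirDeriv Complex.I u z * dirDeriv Complex.I u z

theorem norm_exp_mul_I_sub_exp_mul_I (a b : ℝ) :
    ‖Complex.exp (a * Complex.I) - Complex.exp (b * Complex.I)‖ = 2 * |Real.sin ((a - b) / 2)| := by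
  have h : Complex.exp (a * Complex.I) - Complex.exp (b * Complex.I)
      = Complex.exp (b * Complex.I) * (Complex.exp (Complex.I * ((a - b : ℝ) : ℂ)) - 1) := by
    rw [mul_sub, ← Complex.exp_add, mul_one]
    congr 2
    push_cast
    ring
  rw [h, norm_mul, Complex.norm_exp_ofReal_mul_I, one_mul, Complex.norm_exp_I_mul_ofReal_sub_one]
  simp

theorem injOn_exp_mul_I_Ioc :
    Set.InjOn (fun θ : ℝ => Complex.exp (θ * Complex.I)) (Set.Ioc (-Real.pi) Real.pi) := by
  intro a ha b hb hab
  have := congrArg Complex.arg hab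
  simp only [Complex.arg_exp_mul_I] at this
  have hpi : -Real.pi + 2 * Real.pi = Real.pi := by ring
  rwa [(toIocMod_eq_self _).2 (by rwa [hpi]), (toIocMod_eq_self _).2 (by rwa [hpi])] at this

theorem lipschitzWith_exp_mul_I :
    LipschitzWith 1 (fun θ : ℝ => Complex.exp (θ * Complex.I)) := by
  refine LipschitzWith.of_dist_le_mul fun a b => ?_
  rw [dist_eq_norm, norm_exp_mul_I_sub_exp_mul_I, Real.dist_eq]
  have := Real.abs_sin_le_abs (x := (a - b) / 2)
  rw [abs_div, abs_two] at this
  simp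
  linarith

/-- At scales below `√(1 - L⁻¹)`, the map `θ ↦ exp (θ I)` expands distances up to a factor `L⁻¹`. -/
theorem abs_sub_le_mul_norm_exp_mul_I_sub {L : ℝ} (hL : 1 < L) {a b : ℝ}
    (hab : |a - b| ≤ √(1 - L⁻¹)) :
    |a - b| ≤ L * ‖Complex.exp (a * Complex.I) - Complex.exp (b * Complex.I)‖ := by
  have hL0 : 0 < L := by linarith
  have hnn : 0 ≤ 1 - L⁻¹ := sub_nonneg.2 (inv_le_one_of_one_le₀ hL.le)
  rw [norm_exp_mul_I_sub_exp_mul_I]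
  have h1 := Real.abs_sub_sin_le ((a - b) / 2)
  have h2 := abs_sub_abs_le_abs_sub ((a - b) / 2) (Real.sin ((a - b) / 2))
  have h3 : |a - b| ^ 2 ≤ 1 - L⁻¹ := by
    rw [← Real.sq_sqrt hnn]
    gcongr
  rw [abs_div, abs_two] at h1 h2
  have h4 : |a - b| * |a - b| ^ 2 ≤ |a - b| * (1 - L⁻¹) := by gcongr
  have h5 : |a - b| * L⁻¹ ≤ 2 * |Real.sin ((a - b) / 2)| := by
    nlinarith [abs_nonneg (a - b), mul_nonneg (abs_nonneg (a - b)) hnn]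
  calc |a - b| = L * (|a - b| * L⁻¹) := by field_simp
    _ ≤ _ := by gcongr

theorem volume_le_mul_hausdorffMeasure_image_exp_mul_I {L : NNReal} (hL : 1 < L) {s : Set ℝ}
    (hs : ∀ a ∈ s, ∀ b ∈ s, |a - b| ≤ √(1 - (L : ℝ)⁻¹)) :
    volume s ≤ L * μH[1] ((fun θ : ℝ => Complex.exp (θ * Complex.I)) '' s) := by
  set γ : ℝ → ℂ := fun θ : ℝ => Complex.exp (θ * Complex.I) with hγ
  have hbound : ∀ a ∈ s, ∀ b ∈ s, dist a b ≤ L * dist (γ a) (γ b) := fun a ha b hb => by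
    rw [Real.dist_eq, dist_eq_norm]
    exact abs_sub_le_mul_norm_exp_mul_I_sub (by exact_mod_cast hL) (hs a ha b hb)
  have hinj : Set.InjOn γ s := fun a ha b hb h => by
    have := hbound a ha b hb
    rw [h, dist_self, mul_zero] at this
    exact dist_le_zero.1 this
  have hinv := hinj.leftInvOn_invFunOn
  have hlip : LipschitzOnWith L (Function.invFunOn γ s) (γ '' s) := by
    refine LipschitzOnWith.of_dist_le_mul ?_
    rintro _ ⟨a, ha, rfl⟩ _ ⟨b, hb, rfl⟩
    rw [hinv ha, hinv hb]
    exact hbound a ha b hb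
  have := hlip.hausdorffMeasure_image_le zero_le_one
  rwa [hinv.image_image, MeasureTheory.hausdorffMeasure_real, ENNReal.rpow_one] at this

/-- The arc length of a measurable set of angles is its Lebesgue measure. -/
theorem hausdorffMeasure_image_exp_mul_I {s : Set ℝ} (hs : MeasurableSet s)
    (hsub : s ⊆ Set.Ioc (-Real.pi) Real.pi) :
    μH[1] ((fun θ : ℝ => Complex.exp (θ * Complex.I)) '' s) = volume s := by
  set γ : ℝ → ℂ := fun θ : ℝ => Complex.exp (θ * Complex.I) with hγ
  have hγc : Continuous γ := by fun_prop
  have hinj : Set.InjOn γ s := injOn_exp_mul_I_Ioc.mono hsub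
  apply le_antisymm
  · simpa [MeasureTheory.hausdorffMeasure_real] using
      lipschitzWith_exp_mul_I.hausdorffMeasure_image_le zero_le_one s
  have key : ∀ L : NNReal, 1 < L → volume s ≤ L * μH[1] (γ '' s) := by
    intro L hL
    have hL' : (1 : ℝ) < L := by exact_mod_cast hL
    set δ : ℝ := √(1 - (L : ℝ)⁻¹) with hδ
    have hδ0 : 0 < δ := Real.sqrt_pos.2 (sub_pos.2 (inv_lt_one_of_one_lt₀ hL'))
    let t : ℤ → Set ℝ := fun k => s ∩ (fun x => ⌊x / δ⌋) ⁻¹' {k}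
    have htm : ∀ k, MeasurableSet (t k) := fun k =>
      hs.inter ((Int.measurable_floor.comp (measurable_id.div_const δ)) (measurableSet_singleton k))
    have htd : Pairwise (Function.onFun Disjoint t) := fun i j hij =>
      Set.disjoint_left.2 fun x hx hx' => hij (hx.2.symm.trans hx'.2)
    have hts : s = ⋃ k, t k := by
      ext x
      simp [t]
    have himd : Pairwise (Function.onFun Disjoint fun k => γ '' t k) := fun i j hij => by
      refine Set.disjoint_left.2 ?_
      rintro _ ⟨x, hx, rfl⟩ ⟨y, hy, hxy⟩
      rw [hinj hy.1 hx.1 hxy] at hy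
      exact Set.disjoint_left.1 (htd hij) hx hy
    have himm : ∀ k, MeasurableSet (γ '' t k) := fun k =>
      (htm k).image_of_continuousOn_injOn hγc.continuousOn (hinj.mono Set.inter_subset_left)
    calc volume s = ∑' k, volume (t k) := by
          conv_lhs => rw [hts]
          exact measure_iUnion htd htm
      _ ≤ ∑' k, L * μH[1] (γ '' t k) := by
          refine ENNReal.tsum_le_tsum fun k => ?_
          refine volume_le_mul_hausdorffMeasure_image_exp_mul_I hL fun a ha b hb => ?_
          have h := Int.abs_sub_lt_one_of_floor_eq_floor (ha.2.trans hb.2.symm)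
          rw [← sub_div, abs_div, abs_of_pos hδ0, div_lt_one hδ0] at h
          exact h.le
      _ = L * μH[1] (γ '' s) := by
          rw [ENNReal.tsum_mul_left, ← measure_iUnion himd himm, ← Set.image_iUnion, ← hts]
  have hlim : Tendsto (fun L : NNReal => (L : ENNReal) * μH[1] (γ '' s)) (nhdsWithin 1 (Set.Ioi 1))
      (nhds (1 * μH[1] (γ '' s))) := by
    refine ENNReal.Tendsto.mul_const ?_ (Or.inl one_ne_zero)
    exact (ENNReal.tendsto_coe.2 tendsto_id).mono_left nhdsWithin_le_nhds
  rw [one_mul] at hlim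
  exact ge_of_tendsto hlim (eventually_nhdsWithin_of_forall fun L hL => key L hL)

theorem hausdorffMeasure_restrict_sphere :
    (μH[1] : Measure ℂ).restrict (Metric.sphere 0 1) =
      (volume.restrict (Set.Ioc (-Real.pi) Real.pi)).map
        (fun θ : ℝ => Complex.exp (θ * Complex.I)) := by
  have hγ : Measurable (fun θ : ℝ => Complex.exp (θ * Complex.I)) := by fun_prop
  ext B hB
  rw [Measure.map_apply hγ hB, Measure.restrict_apply hB, Measure.restrict_apply (hγ hB),
    ← hausdorffMeasure_image_exp_mul_I ((hγ hB).inter measurableSet_Ioc) Set.inter_subset_right]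
  congr 1
  ext z
  constructor
  · rintro ⟨hzB, hz⟩
    have : Complex.exp (z.arg * Complex.I) = z := by
      have := Complex.norm_mul_exp_arg_mul_I z
      rwa [mem_sphere_zero_iff_norm.1 hz, Complex.ofReal_one, one_mul] at this
    exact ⟨z.arg, ⟨by simpa [this] using hzB, Complex.arg_mem_Ioc z⟩, this⟩
  · rintro ⟨θ, ⟨hθ, -⟩, rfl⟩
    exact ⟨hθ, by simp [Complex.norm_exp_ofReal_mul_I]⟩

theorem integral_sphere_hausdorffMeasure {f : ℂ → ℝ} (hf : Continuous f) :
    ∫ z in Metric.sphere 0 1, f z ∂μH[1] =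
      ∫ θ in -Real.pi..Real.pi, f (Complex.exp (θ * Complex.I)) := by
  have hγ : Continuous (fun θ : ℝ => Complex.exp (θ * Complex.I)) := by fun_prop
  rw [hausdorffMeasure_restrict_sphere,
    integral_map hγ.aemeasurable hf.aestronglyMeasurable,
    intervalIntegral.integral_of_le (by linarith [Real.pi_pos])]

theorem hasFDerivAt_polarCoord_symm_complex (p : ℝ × ℝ) :
    ∃ φ' : ℝ × ℝ →L[ℝ] ℂ,
      HasFDerivAt (fun p : ℝ × ℝ => (p.1 : ℂ) * (Real.cos p.2 + Real.sin p.2 * Complex.I)) φ' p ∧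
      φ' (1, 0) = Real.cos p.2 • (1 : ℂ) + Real.sin p.2 • Complex.I ∧
      φ' (0, 1) = (-(p.1 * Real.sin p.2)) • (1 : ℂ) + (p.1 * Real.cos p.2) • Complex.I := by
  have h1 : HasFDerivAt (fun p : ℝ × ℝ => (p.1 : ℂ)) _ p :=
    Complex.ofRealCLM.hasFDerivAt.comp p hasFDerivAt_fst
  have hc : HasFDerivAt (fun p : ℝ × ℝ => ((Real.cos p.2 : ℝ) : ℂ)) _ p :=
    Complex.ofRealCLM.hasFDerivAt.comp p hasFDerivAt_snd.cos
  have hs : HasFDerivAt (fun p : ℝ × ℝ => ((Real.sin p.2 : ℝ) : ℂ)) _ p :=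
    Complex.ofRealCLM.hasFDerivAt.comp p hasFDerivAt_snd.sin
  refine ⟨_, h1.mul (hc.add (hs.mul_const Complex.I)), ?_, ?_⟩
  · simp
  · simp
    ring

/-- The divergence theorem on the unit disk. -/
theorem integral_ball_divergence {P Q : ℂ → ℝ} (hP : ContDiff ℝ 1 P) (hQ : ContDiff ℝ 1 Q) :
    ∫ z in Metric.ball 0 1, (fderiv ℝ P z 1 + fderiv ℝ Q z Complex.I) =
      ∫ z in Metric.sphere 0 1, (P z * z.re + Q z * z.im) ∂μH[1] := by
  have hPc := hP.continuous
  have hQc := hQ.continuous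
  have hP' : Continuous fun z => fderiv ℝ P z 1 :=
    (hP.continuous_fderiv one_ne_zero).clm_apply continuous_const
  have hQ' : Continuous fun z => fderiv ℝ Q z Complex.I :=
    (hQ.continuous_fderiv one_ne_zero).clm_apply continuous_const
  rw [integral_sphere_hausdorffMeasure (by fun_prop)]
  set D : ℂ → ℝ := fun z => fderiv ℝ P z 1 + fderiv ℝ Q z Complex.I with hD
  have hDc : Continuous D := hP'.add hQ'
  let φ : ℝ × ℝ → ℂ := fun p => (p.1 : ℂ) * (Real.cos p.2 + Real.sin p.2 * Complex.I)
  have hφ : Continuous φ := by fun_prop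
  let f : ℝ × ℝ → ℝ := fun p => p.1 * (P (φ p) * Real.cos p.2 + Q (φ p) * Real.sin p.2)
  let g : ℝ × ℝ → ℝ := fun p => Q (φ p) * Real.cos p.2 - P (φ p) * Real.sin p.2
  have hder : ∀ p : ℝ × ℝ, ∃ f' g' : ℝ × ℝ →L[ℝ] ℝ, HasFDerivAt f f' p ∧ HasFDerivAt g g' p ∧
      f' (1, 0) + g' (0, 1) = p.1 * D (φ p) := by
    intro p
    obtain ⟨φ', hφ', e1, e2⟩ := hasFDerivAt_polarCoord_symm_complex p
    have hPd : HasFDerivAt (fun p => P (φ p)) _ p :=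
      (hP.differentiable one_ne_zero (φ p)).hasFDerivAt.comp p hφ'
    have hQd : HasFDerivAt (fun p => Q (φ p)) _ p :=
      (hQ.differentiable one_ne_zero (φ p)).hasFDerivAt.comp p hφ'
    have hc : HasFDerivAt (fun p : ℝ × ℝ => Real.cos p.2) _ p := hasFDerivAt_snd.cos
    have hs : HasFDerivAt (fun p : ℝ × ℝ => Real.sin p.2) _ p := hasFDerivAt_snd.sin
    have hT1 (T : ℂ →L[ℝ] ℝ) :
        T (φ' (1, 0)) = Real.cos p.2 * T 1 + Real.sin p.2 * T Complex.I := by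
      rw [e1, map_add, map_smul, map_smul, smul_eq_mul, smul_eq_mul]
    have hT2 (T : ℂ →L[ℝ] ℝ) :
        T (φ' (0, 1)) = -(p.1 * Real.sin p.2) * T 1 + p.1 * Real.cos p.2 * T Complex.I := by
      rw [e2, map_add, map_smul, map_smul, smul_eq_mul, smul_eq_mul]
    refine ⟨_, _, hasFDerivAt_fst.mul ((hPd.mul hc).add (hQd.mul hs)),
      (hQd.mul hc).sub (hPd.mul hs), ?_⟩
    simp [hT1, hT2, hD]
    linear_combination p.1 * (fderiv ℝ P (φ p) 1 + fderiv ℝ Q (φ p) Complex.I) *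
      Real.sin_sq_add_cos_sq p.2
  choose f' g' hf hg hfg using hder
  have hfc : Continuous f := by fun_prop
  have hgc : Continuous g := by fun_prop
  have hpolar : ∫ z in Metric.ball 0 1, D z =
      ∫ p in Set.Icc ((0 : ℝ), -Real.pi) (1, Real.pi), p.1 * D (φ p) := by
    rw [← integral_indicator Metric.isOpen_ball.measurableSet,
      ← Complex.integral_comp_polarCoord_symm, polarCoord_target]
    have hset : (Set.Ioi (0 : ℝ) ×ˢ Set.Ioo (-Real.pi) Real.pi) ∩ {p : ℝ × ℝ | p.1 < 1} =
        Set.Ioo 0 1 ×ˢ Set.Ioo (-Real.pi) Real.pi := by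
      ext p
      simp
      tauto
    have hae : (Set.Ioo (0 : ℝ) 1 ×ˢ Set.Ioo (-Real.pi) Real.pi : Set (ℝ × ℝ)) =ᵐ[volume]
        Set.Icc ((0 : ℝ), -Real.pi) (1, Real.pi) := by
      rw [Set.Icc_prod_eq]
      exact Measure.set_prod_ae_eq Ioo_ae_eq_Icc Ioo_ae_eq_Icc
    rw [← setIntegral_congr_set hae, ← hset,
      ← setIntegral_indicator (measurableSet_lt measurable_fst measurable_const)]
    refine setIntegral_congr_fun (measurableSet_Ioi.prod measurableSet_Ioo) fun p hp => ?_
    have hp0 : 0 < p.1 := hp.1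
    have hn : ‖φ p‖ = p.1 := by
      rw [← abs_of_pos hp0, ← Complex.norm_polarCoord_symm, Complex.polarCoord_symm_apply]
    simp only [Complex.polarCoord_symm_apply, smul_eq_mul]
    change p.1 * (Metric.ball 0 1).indicator D (φ p) = _
    by_cases h : p.1 < 1
    · rw [Set.indicator_of_mem (by simpa [hn] using h), Set.indicator_of_mem (by exact h)]
    · rw [Set.indicator_of_notMem (by simpa [hn] using h),
        Set.indicator_of_notMem (by exact h), mul_zero]
  have hdiv := integral_divergence_prod_Icc_of_hasFDerivAt_of_le f g f' g' (0, -Real.pi)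
    (1, Real.pi) ⟨zero_le_one, by simpa using Real.pi_pos.le⟩ hfc.continuousOn hgc.continuousOn
    (fun p _ => hf p) (fun p _ => hg p) (by
      simp only [hfg]
      exact (by fun_prop : Continuous fun p : ℝ × ℝ => p.1 * D (φ p)).continuousOn.integrableOn_Icc)
  simp only [hfg] at hdiv
  rw [hpolar, hdiv]
  simp [f, g, φ, Complex.exp_mul_I, Complex.cos_ofReal_re, Complex.sin_ofReal_re]

theorem contDiff_dirDeriv {u : ℂ → ℝ} (hu : ContDiff ℝ 2 u) (v : ℂ) :
    ContDiff ℝ 1 (dirDeriv v u) :=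
  (hu.fderiv_right (m := 1) (by norm_num)).clm_apply contDiff_const

theorem dirDeriv_comm {u : ℂ → ℝ} (hu : ContDiff ℝ 2 u) (v w z : ℂ) :
    dirDeriv v (dirDeriv w u) z = dirDeriv w (dirDeriv v u) z := by
  have hd : DifferentiableAt ℝ (fderiv ℝ u) z :=
    (hu.fderiv_right (m := 1) (by norm_num)).differentiable one_ne_zero z
  have key : ∀ a b : ℂ, dirDeriv a (dirDeriv b u) z = fderiv ℝ (fderiv ℝ u) z a b := by
    intro a b
    change fderiv ℝ (fun y => fderiv ℝ u y b) z a = _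
    rw [fderiv_clm_apply hd (differentiableAt_const b)]
    simp
  rw [key, key]
  exact hu.contDiffAt.isSymmSndFDerivAt (by simp) v w

/-- The vector field whose divergence gives the Pohozaev identity, in direction `v`:
`2 K e^u (F · v) + (∇u · F) ∂ᵥu - |∇u|²/2 (F · v)`. -/
def pohozaevField (K u : ℂ → ℝ) (F : ℂ → ℂ) (v : ℂ) (z : ℂ) : ℝ :=
  2 * (K z * Real.exp (u z)) * dot (F z) v
    + (dirDeriv 1 u z * (F z).re + dirDeriv Complex.I u z * (F z).im) * dirDeriv v u z
    - (dirDeriv 1 u z * dirDeriv 1 u z + dirDeriv Complex.I u z * dirDeriv Complex.I u z) / 2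
      * dot (F z) v

theorem contDiff_pohozaevField {K u : ℂ → ℝ} {F : ℂ → ℂ} (hu : ContDiff ℝ 2 u)
    (hK : ContDiff ℝ 1 K) (hF : ContDiff ℝ 1 F) (v : ℂ) :
    ContDiff ℝ 1 (pohozaevField K u F v) := by
  have h1 := contDiff_dirDeriv hu 1
  have h2 := contDiff_dirDeriv hu Complex.I
  have hv := contDiff_dirDeriv hu v
  have hre : ContDiff ℝ 1 fun z => (F z).re := Complex.reCLM.contDiff.comp hF
  have him : ContDiff ℝ 1 fun z => (F z).im := Complex.imCLM.contDiff.comp hF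
  have hu1 : ContDiff ℝ 1 u := hu.of_le (by norm_num)
  unfold pohozaevField dot
  fun_prop

theorem fderiv_pohozaevField_apply {K u : ℂ → ℝ} {F : ℂ → ℂ} (hu : ContDiff ℝ 2 u)
    (hK : ContDiff ℝ 1 K) (hF : ContDiff ℝ 1 F) (v w z : ℂ) :
    fderiv ℝ (pohozaevField K u F v) z w =
      2 * (dirDeriv w K z + K z * dirDeriv w u z) * Real.exp (u z) * dot (F z) v
      + 2 * K z * Real.exp (u z) *
        (fderiv ℝ (fun w => (F w).re) z w * v.re + fderiv ℝ (fun w => (F w).im) z w * v.im)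
      + (dirDeriv w (dirDeriv 1 u) z * (F z).re + dirDeriv 1 u z * fderiv ℝ (fun w => (F w).re) z w
        + dirDeriv w (dirDeriv Complex.I u) z * (F z).im
        + dirDeriv Complex.I u z * fderiv ℝ (fun w => (F w).im) z w) * dirDeriv v u z
      + (dirDeriv 1 u z * (F z).re + dirDeriv Complex.I u z * (F z).im)
        * dirDeriv w (dirDeriv v u) z
      - (dirDeriv 1 u z * dirDeriv w (dirDeriv 1 u) z
        + dirDeriv Complex.I u z * dirDeriv w (dirDeriv Complex.I u) z) * dot (F z) v
      - (dirDeriv 1 u z * dirDeriv 1 u z + dirDeriv Complex.I u z * dirDeriv Complex.I u z) / 2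
        * (fderiv ℝ (fun w => (F w).re) z w * v.re + fderiv ℝ (fun w => (F w).im) z w * v.im) := by
  have h1 := ((contDiff_dirDeriv hu 1).differentiable one_ne_zero z).hasFDerivAt
  have h2 := ((contDiff_dirDeriv hu Complex.I).differentiable one_ne_zero z).hasFDerivAt
  have hv := ((contDiff_dirDeriv hu v).differentiable one_ne_zero z).hasFDerivAt
  have hre := ((Complex.reCLM.contDiff.comp hF).differentiable one_ne_zero z).hasFDerivAt
  have him := ((Complex.imCLM.contDiff.comp hF).differentiable one_ne_zero z).hasFDerivAt
  have hu1 := (hu.differentiable two_ne_zero z).hasFDerivAt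
  have hK1 := (hK.differentiable one_ne_zero z).hasFDerivAt
  have hdot := (hre.mul_const v.re).add (him.mul_const v.im)
  have hmain := ((((hK1.mul hu1.exp).const_mul 2).mul hdot).add
    (((h1.mul hre).add (h2.mul him)).mul hv)).sub
    ((((h1.mul h1).add (h2.mul h2)).mul_const (2⁻¹ : ℝ)).mul hdot)
  have hfield := hmain.congr_of_eventuallyEq (f₁ := pohozaevField K u F v)
    (.of_forall fun y => by simp [pohozaevField, dot, div_eq_mul_inv])
  refine (DFunLike.congr_fun hfield.fderiv w).trans ?_
  simp [dirDeriv, dot, Function.comp_def]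
  ring

/-- the Pohozaev-type identity for solutions of the prescribed
curvature problem on the disk, for an arbitrary C¹ vector field `F`. -/
theorem pohozaev_identity
    (K h u : ℂ → ℝ) (F : ℂ → ℂ)
    (hureg : ContDiff ℝ 2 u) (hKreg : ContDiff ℝ 1 K) (hhreg : ContDiff ℝ 1 h)
    (hFreg : ContDiff ℝ 1 F)
    (hsol : SolvesLiouville K h u) :
    (∫ z in unitCircle,
      (2 * K z * Real.exp (u z) * dot (F z) z
        + (2 * h z * Real.exp (u z / 2) - 2) * dot (grad u z) (F z)
        - dot (grad u z) (grad u z) / 2 * dot (F z) z) ∂arcMeasure)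
    = ∫ z in unitDisk,
        (2 * Real.exp (u z) * (dot (grad K z) (F z) + K z * divergence F z)
          + DFQuad F u z
          - divergence F z * (dot (grad u z) (grad u z) / 2)) := by
  have hdiv := integral_ball_divergence (contDiff_pohozaevField hureg hKreg hFreg 1)
    (contDiff_pohozaevField hureg hKreg hFreg Complex.I)
  refine Eq.trans ?_ (hdiv.symm.trans ?_)
  · refine setIntegral_congr_fun Metric.isClosed_sphere.measurableSet fun z hz => ?_
    have hN : normalDeriv u z = z.re * dirDeriv 1 u z + z.im * dirDeriv Complex.I u z := by
      have : z = z.re • (1 : ℂ) + z.im • Complex.I := by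
        simp
      unfold normalDeriv dirDeriv
      conv_lhs => rw [this, map_add, map_smul, map_smul]
      simp
    have hB := hsol.2 z hz
    simp only [← hB, hN, pohozaevField, dot, grad, Complex.one_re, Complex.one_im, Complex.I_re,
      Complex.I_im]
    ring
  · refine setIntegral_congr_fun Metric.isOpen_ball.measurableSet fun z hz => ?_
    have hE := hsol.1 z hz
    have hS := dirDeriv_comm hureg 1 Complex.I z
    unfold lap at hE
    simp only [fderiv_pohozaevField_apply hureg hKreg hFreg]
    simp only [divergence, DFQuad, dot, grad, Complex.one_re, Complex.one_im, Complex.I_re,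
      Complex.I_im, hS]
    linear_combination (-(dirDeriv 1 u z * (F z).re + dirDeriv Complex.I u z * (F z).im)) * hE
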